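/- For every n ≥ 1, the following identity holds in the polynomial ring ℚ[α]: ∑_{T ∈ BT_n} ∏_{v ∈ T} ((h_v + 1)α + 1 − h_v)/(2 h_v) = (1/(n+1)) · binom((n+1)α, n), where BT_n is the set of binary trees with n nodes, h_v is the hook length of the node v, and binom(x, n) = x(x−1)⋯(x−n+1)/n! is the generalized binomial coefficient. -/

import Mathlib

/-- Incomplete binary trees: either empty, or a root node with a left and a right subtree. -/
inductive BT : Type
  | nil : BT
  | node : BT → BT → BT
  deriving DecidableEq

namespace BT

/-- Number of nodes of a binary tree. -/
def size : BT → ℕ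
  | nil => 0
  | node l r => size l + size r + 1

end BT

open Polynomial

/-- The product `∏_{v ∈ T} ((h_v+1)α + 1 - h_v)/(2h_v)` over all nodes `v` of the binary
tree `T`, as a polynomial in `α = X`; `h_v` is the hook length of `v`. -/
noncomputable def hookTermProd : BT → Polynomial ℚ
  | BT.nil => 1
  | BT.node l r =>
      C ((2 * (l.size + r.size + 1 : ℕ) : ℕ) : ℚ)⁻¹
          * (C (((l.size + r.size + 2 : ℕ) : ℚ)) * X
              + C (1 - ((l.size + r.size + 1 : ℕ) : ℚ)))
        * hookTermProd l * hookTermProd r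

/-- The finset of binary trees with `n` nodes. -/
def BT.trees : ℕ → Finset BT
  | 0 => {BT.nil}
  | n + 1 =>
      (Finset.HasAntidiagonal.antidiagonal n).attach.biUnion fun ij =>
        (BT.trees ij.1.1 ×ˢ BT.trees ij.1.2).image fun p => BT.node p.1 p.2
  decreasing_by
    all_goals
      have := Finset.HasAntidiagonal.mem_antidiagonal.1 ij.2
      omega

theorem BT.trees_succ (n : ℕ) :
    BT.trees (n + 1) = (Finset.HasAntidiagonal.antidiagonal n).biUnion fun ij =>
      (BT.trees ij.1 ×ˢ BT.trees ij.2).image fun p => BT.node p.1 p.2 := by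
  rw [BT.trees]
  ext T
  simp

theorem BT.mem_trees {T : BT} {n : ℕ} : T ∈ BT.trees n ↔ T.size = n := by
  induction T generalizing n with
  | nil => cases n <;> simp [BT.trees, BT.trees_succ, BT.size]
  | node l r ihl ihr =>
    cases n with
    | zero => simp [BT.trees, BT.size]
    | succ n =>
      simp only [BT.trees_succ, Finset.mem_biUnion, Finset.HasAntidiagonal.mem_antidiagonal, Finset.mem_image,
        Finset.mem_product, BT.node.injEq, Prod.exists, BT.size]
      constructor
      · rintro ⟨i, j, hij, l', r', ⟨hl, hr⟩, rfl, rfl⟩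
        have := ihl.1 hl
        have := ihr.1 hr
        omega
      · intro h
        exact ⟨l.size, r.size, by omega, l, r, ⟨ihl.2 rfl, ihr.2 rfl⟩, rfl, rfl⟩

theorem BT.sum_trees_succ {M : Type*} [AddCommMonoid M] (n : ℕ) (f : BT → M) :
    ∑ T ∈ BT.trees (n + 1), f T =
      ∑ ij ∈ Finset.HasAntidiagonal.antidiagonal n,
        ∑ l ∈ BT.trees ij.1, ∑ r ∈ BT.trees ij.2, f (BT.node l r) := by
  rw [BT.trees_succ, Finset.sum_biUnion]
  · refine Finset.sum_congr rfl fun ij _ => ?_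
    rw [Finset.sum_image, Finset.sum_product]
    rintro ⟨l, r⟩ _ ⟨l', r'⟩ _ h
    simpa using h
  · rintro ⟨i, j⟩ _ ⟨i', j'⟩ _ hne
    refine Finset.disjoint_left.2 fun T hT hT' => hne ?_
    simp only [Finset.mem_image, Finset.mem_product, BT.mem_trees, Prod.exists] at hT hT'
    obtain ⟨l, r, ⟨rfl, rfl⟩, rfl⟩ := hT
    obtain ⟨l', r', ⟨rfl, rfl⟩, h⟩ := hT'
    obtain ⟨rfl, rfl⟩ := BT.node.inj h
    rfl

theorem descPochhammer_eval_succ_left (n : ℕ) (x : ℚ) :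
    (descPochhammer ℚ (n + 1)).eval x = x * (descPochhammer ℚ n).eval (x - 1) := by
  simp [descPochhammer_succ_left]

theorem descPochhammer_eval_succ_right (n : ℕ) (x : ℚ) :
    (descPochhammer ℚ (n + 1)).eval x = (descPochhammer ℚ n).eval x * (x - n) := by
  simp [descPochhammer_succ_right]

/-- The Rothe polynomial `x / (x + n z) * binom(x + n z, n)`, as a polynomial in `x`. -/
noncomputable def rothePoly (z : ℚ) : ℕ → ℚ[X]
  | 0 => 1
  | n + 1 => C ((n + 1).factorial : ℚ)⁻¹ * X *
      (descPochhammer ℚ n).comp (X + C ((n + 1) * z - 1))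

theorem rothePoly_zero_eval (z x : ℚ) : (rothePoly z 0).eval x = 1 := by
  simp [rothePoly]

theorem rothePoly_succ_eval (z : ℚ) (n : ℕ) (x : ℚ) :
    (rothePoly z (n + 1)).eval x = ((n + 1).factorial : ℚ)⁻¹ * x *
      (descPochhammer ℚ n).eval (x + ((n + 1) * z - 1)) := by
  simp [rothePoly]

theorem rothePoly_eval_add_one (z : ℚ) (n : ℕ) (x : ℚ) :
    (rothePoly z (n + 1)).eval (x + 1) =
      (rothePoly z (n + 1)).eval x + (rothePoly z n).eval (x + z) := by
  cases n with
  | zero => simp [rothePoly]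
  | succ n =>
    rw [rothePoly_succ_eval, rothePoly_succ_eval, rothePoly_succ_eval,
      descPochhammer_eval_succ_left, descPochhammer_eval_succ_right]
    have h₁ : x + 1 + (((n + 1 : ℕ) + 1) * z - 1) - 1 = x + (((n + 1 : ℕ) + 1) * z - 1) := by ring
    have h₂ : x + z + ((n + 1) * z - 1) = x + (((n + 1 : ℕ) + 1) * z - 1) := by push_cast; ring
    rw [h₁, h₂, Nat.factorial_succ (n + 1)]
    have := Nat.factorial_ne_zero (n + 1)
    push_cast
    field_simp
    ring

/-- The **Rothe–Hagen identity**. -/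
theorem sum_rothePoly_mul_rothePoly (z : ℚ) (n : ℕ) (x y : ℚ) :
    ∑ ij ∈ Finset.HasAntidiagonal.antidiagonal n, (rothePoly z ij.1).eval x * (rothePoly z ij.2).eval y =
      (rothePoly z n).eval (x + y) := by
  induction n generalizing x with
  | zero => simp [rothePoly]
  | succ n ih =>
    have key : ∀ k : ℕ, ∑ ij ∈ Finset.HasAntidiagonal.antidiagonal (n + 1),
        (rothePoly z ij.1).eval (k : ℚ) * (rothePoly z ij.2).eval y =
          (rothePoly z (n + 1)).eval (k + y) := by
      intro k
      induction k with
      | zero =>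
        rw [Finset.Nat.sum_antidiagonal_succ]
        simp [rothePoly]
      | succ k ihk =>
        rw [Finset.Nat.sum_antidiagonal_succ] at ihk ⊢
        push_cast
        simp only [rothePoly_eval_add_one, add_mul, Finset.sum_add_distrib]
        rw [ih, add_right_comm (k : ℚ) 1 y, rothePoly_eval_add_one, ← ihk,
          add_right_comm (k : ℚ) z y]
        simp only [rothePoly_zero_eval]
        ring
    have hpoly : ∑ ij ∈ Finset.HasAntidiagonal.antidiagonal (n + 1),
        rothePoly z ij.1 * C ((rothePoly z ij.2).eval y) =
          (rothePoly z (n + 1)).comp (X + C y) := by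
      refine Polynomial.eq_of_infinite_eval_eq _ _
        ((Set.infinite_range_of_injective (Nat.cast_injective (R := ℚ))).mono ?_)
      rintro _ ⟨k, rfl⟩
      simpa [Polynomial.eval_finsetSum] using key k
    simpa [Polynomial.eval_finsetSum] using congrArg (Polynomial.eval x) hpoly

theorem sum_trees_hookTermProd_eval (n : ℕ) (a : ℚ) :
    ∑ T ∈ BT.trees n, (hookTermProd T).eval a = (rothePoly a n).eval a := by
  induction n using Nat.strong_induction_on with
  | _ n ih =>
    cases n with
    | zero => simp [BT.trees, hookTermProd, rothePoly]
    | succ n =>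
      have hsum : ∑ T ∈ BT.trees (n + 1), (hookTermProd T).eval a =
          (2 * (n + 1 : ℚ))⁻¹ * ((n + 2) * a - n) * (rothePoly a n).eval (a + a) := by
        rw [BT.sum_trees_succ, ← sum_rothePoly_mul_rothePoly, Finset.mul_sum]
        refine Finset.sum_congr rfl fun ij hij => ?_
        have hij' := Finset.HasAntidiagonal.mem_antidiagonal.1 hij
        rw [← ih ij.1 (by omega), ← ih ij.2 (by omega), Finset.sum_mul_sum, Finset.mul_sum]
        refine Finset.sum_congr rfl fun l hl => ?_
        rw [Finset.mul_sum]
        refine Finset.sum_congr rfl fun r hr => ?_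
        have hsize : l.size + r.size = n := by
          rw [BT.mem_trees.1 hl, BT.mem_trees.1 hr, hij']
        simp only [hookTermProd, hsize, eval_mul, eval_add, eval_C, eval_X]
        push_cast
        ring
      rw [hsum]
      cases n with
      | zero => simp [rothePoly]
      | succ n =>
        rw [rothePoly_succ_eval, rothePoly_succ_eval, descPochhammer_eval_succ_right]
        have h : a + a + ((n + 1) * a - 1) = a + (((n + 1 : ℕ) + 1) * a - 1) := by
          push_cast; ring
        rw [h, Nat.factorial_succ (n + 1)]
        have := Nat.factorial_ne_zero (n + 1)
        push_cast
        field_simp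
        ring

/-- **The Du–Liu form of Lascoux's identity**, in `ℚ[α]`:
`∑_{T ∈ BT_n} ∏_{v ∈ T} ((h_v+1)α + 1 - h_v)/(2h_v) = (1/(n+1)) binom((n+1)α, n)`,
the (finite) sum being over all binary trees with `n` nodes; here
`binom(x, n) = x(x-1)⋯(x-n+1)/n!`, so `binom((n+1)α, n)` is the descending Pochhammer
polynomial of degree `n` composed with `(n+1)α`, divided by `n!`. -/
theorem du_liu_identity (n : ℕ) (hn : 1 ≤ n) :
    ∑ᶠ T ∈ {T : BT | T.size = n}, hookTermProd T
      = C (((n + 1 : ℕ) : ℚ))⁻¹ * C ((Nat.factorial n : ℚ))⁻¹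
        * (descPochhammer ℚ n).comp (C (((n + 1 : ℕ) : ℚ)) * X) := by
  have htrees : {T : BT | T.size = n} = (BT.trees n : Set BT) := by
    ext T
    simp [BT.mem_trees]
  rw [htrees, finsum_mem_coe_finset]
  refine Polynomial.funext fun a => ?_
  rw [Polynomial.eval_finsetSum, sum_trees_hookTermProd_eval]
  obtain ⟨m, rfl⟩ := Nat.exists_eq_add_of_le' hn
  simp only [eval_mul, eval_comp, eval_C, eval_X]
  rw [rothePoly_succ_eval, descPochhammer_eval_succ_left]
  have h : a + ((m + 1) * a - 1) = ((m + 1 + 1 : ℕ) : ℚ) * a - 1 := by push_cast; ring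
  rw [h]
  have : ((m + 1 + 1 : ℕ) : ℚ) ≠ 0 := by positivity
  field_simp
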